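/- Let τ > 0, σ > 0 and λ > τ/2 be real. Then ∫₀^∞ (sin(√(τ²x² + σ²))/√(τ²x² + σ²)) · sin⁴(λx)/x⁴ dx = (π·τ³/(16σ²))·J₂(σ) + (π·τ²·λ/(8σ³))·(σ·cos(σ) − sin(σ)) + (π·λ³/(3σ))·sin(σ), where J₂(σ) = Σ_{k=0}^{∞} ((−1)^k/(k!·(k+2)!))·(σ/2)^{2k+2} is the Bessel function of the first kind of order 2. -/

import Mathlib

open MeasureTheory Nat

lemma aux_gamma (x : ℝ) (hx : 0 < x) :
    ∫ s in Set.Ioi (0:ℝ), s ^ 3 * Real.exp (-(x * s)) = 6 / x ^ 4 := by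
  have h := Real.integral_rpow_mul_exp_neg_mul_Ioi (a := 4) (r := x) (by norm_num) hx
  have hG : Real.Gamma 4 = 6 := by
    have := Real.Gamma_nat_eq_factorial 3
    rw [show ((3:ℕ):ℝ) + 1 = 4 by norm_num] at this
    rw [this]; norm_num [Nat.factorial]
  rw [hG] at h
  have e1 : ∀ s : ℝ, s ^ ((4:ℝ) - 1) = s ^ 3 := by
    intro s
    rw [show (4:ℝ) - 1 = ((3:ℕ):ℝ) by norm_num, Real.rpow_natCast]
  simp_rw [e1] at h
  rw [h, show (4:ℝ) = ((4:ℕ):ℝ) by norm_num, Real.rpow_natCast]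
  field_simp

lemma aux_gamma_int (x : ℝ) (hx : 0 < x) :
    IntegrableOn (fun s : ℝ => s ^ 3 * Real.exp (-(x * s))) (Set.Ioi 0) := by
  by_contra h
  have := aux_gamma x hx
  rw [integral_undef h] at this
  have : 0 < 6 / x ^ 4 := by positivity
  linarith

lemma aux_cexp_re (b s x : ℝ) :
    (Complex.exp ((-(s:ℂ) + b * Complex.I) * x)).re = Real.exp (-(s * x)) * Real.cos (b * x) := by
  rw [Complex.exp_re]
  simp

lemma aux_cos_exp_int (b s : ℝ) (hs : 0 < s) :
    IntegrableOn (fun x : ℝ => Real.exp (-(s * x)) * Real.cos (b * x)) (Set.Ioi 0) := by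
  have h := integrableOn_exp_mul_complex_Ioi (a := -(s:ℂ) + b * Complex.I) (by simpa using hs) 0
  have := h.re
  unfold IntegrableOn
  simpa [aux_cexp_re] using this

lemma aux_cos_exp (b s : ℝ) (hs : 0 < s) :
    ∫ x in Set.Ioi (0:ℝ), Real.exp (-(s * x)) * Real.cos (b * x) = s / (s ^ 2 + b ^ 2) := by
  have h := integrableOn_exp_mul_complex_Ioi (a := -(s:ℂ) + b * Complex.I) (by simpa using hs) 0
  have h2 := integral_exp_mul_complex_Ioi (a := -(s:ℂ) + b * Complex.I) (by simpa using hs) 0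
  have h3 := integral_re h
  rw [h2] at h3
  simp_rw [← aux_cexp_re]
  rw [show (∫ x in Set.Ioi (0:ℝ), (Complex.exp ((-(s:ℂ) + b * Complex.I) * x)).re) = _ from h3]
  simp [Complex.div_re, Complex.normSq_apply]
  field_simp

lemma aux_arctan (b : ℝ) :
    IntegrableOn (fun s : ℝ => b ^ 4 / (s ^ 2 + b ^ 2)) (Set.Ioi 0) ∧
    ∫ s in Set.Ioi (0:ℝ), b ^ 4 / (s ^ 2 + b ^ 2) = |b| ^ 3 * (Real.pi / 2) := by
  rcases eq_or_ne b 0 with rfl | hb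
  · simp
  have hb' : 0 < |b| := abs_pos.mpr hb
  have e : ∀ s : ℝ, b ^ 4 / (s ^ 2 + b ^ 2) = b ^ 2 * (1 + (|b|⁻¹ * s) ^ 2)⁻¹ := by
    intro s
    rw [mul_pow, inv_pow, sq_abs]
    have : 0 < s ^ 2 + b ^ 2 := by positivity
    have : 0 < b ^ 2 + s ^ 2 := by positivity
    field_simp
    ring
  simp_rw [e]
  constructor
  · apply Integrable.const_mul
    exact (integrable_inv_one_add_sq.comp_mul_left' (inv_ne_zero hb'.ne')).integrableOn
  · rw [integral_const_mul, integral_comp_mul_left_Ioi (fun s => (1 + s ^ 2)⁻¹) 0 (inv_pos.mpr hb')]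
    simp
    rw [← sq_abs b]; ring

lemma aux_kernel {ι : Type} (S : Finset ι) (c b : ι → ℝ) (h0 : ∑ i ∈ S, c i = 0)
    (h2 : ∑ i ∈ S, c i * b i ^ 2 = 0)
    (hint : IntegrableOn (fun x : ℝ => (∑ i ∈ S, c i * Real.cos (b i * x)) / x ^ 4) (Set.Ioi 0)) :
    ∫ x in Set.Ioi (0:ℝ), (∑ i ∈ S, c i * Real.cos (b i * x)) / x ^ 4 =
      Real.pi / 12 * ∑ i ∈ S, c i * |b i| ^ 3 := by
  set P : ℝ → ℝ := fun x => ∑ i ∈ S, c i * Real.cos (b i * x) with hP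
  have hPc : Continuous P := by fun_prop
  have e1 : ∫ x in Set.Ioi (0:ℝ), P x / x ^ 4 =
      ∫ x in Set.Ioi (0:ℝ), ∫ s in Set.Ioi (0:ℝ), P x / 6 * (s ^ 3 * Real.exp (-(x * s))) := by
    apply setIntegral_congr_fun measurableSet_Ioi
    intro x hx
    simp only
    rw [integral_const_mul, aux_gamma x hx]
    ring
  have hI : Integrable (Function.uncurry fun x s : ℝ => P x / 6 * (s ^ 3 * Real.exp (-(x * s))))
      ((volume.restrict (Set.Ioi 0)).prod (volume.restrict (Set.Ioi 0))) := by
    rw [integrable_prod_iff]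
    · constructor
      · filter_upwards [ae_restrict_mem measurableSet_Ioi] with x hx
        exact (aux_gamma_int x hx).const_mul (P x / 6)
      · apply hint.norm.congr
        filter_upwards [ae_restrict_mem measurableSet_Ioi] with x hx
        have hx : 0 < x := hx
        have : ∫ s in Set.Ioi (0:ℝ), ‖P x / 6 * (s ^ 3 * Real.exp (-(x * s)))‖ =
            ∫ s in Set.Ioi (0:ℝ), |P x| / 6 * (s ^ 3 * Real.exp (-(x * s))) := by
          apply setIntegral_congr_fun measurableSet_Ioi
          intro s hs
          have hs : 0 < s := hs
          simp only [norm_mul, Real.norm_eq_abs, abs_div, abs_pow, Real.abs_exp, abs_of_pos hs]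
          norm_num
        simp only [Function.uncurry]
        rw [this, integral_const_mul, aux_gamma x hx, norm_div, Real.norm_eq_abs, norm_pow,
          Real.norm_eq_abs, abs_of_pos hx]
        simp only [hP]
        ring
    · apply Continuous.aestronglyMeasurable
      simp only [Function.uncurry_def]
      fun_prop
  rw [show (∫ x in Set.Ioi (0:ℝ), (∑ i ∈ S, c i * Real.cos (b i * x)) / x ^ 4) = _ from e1,
    integral_integral_swap hI]
  have e2 : ∀ s ∈ Set.Ioi (0:ℝ), ∫ x in Set.Ioi (0:ℝ), P x / 6 * (s ^ 3 * Real.exp (-(x * s))) =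
      ∑ i ∈ S, c i / 6 * (b i ^ 4 / (s ^ 2 + b i ^ 2)) := by
    intro s hs
    have hs : 0 < s := hs
    have e3 : ∀ x, P x / 6 * (s ^ 3 * Real.exp (-(x * s))) =
        ∑ i ∈ S, (c i * s ^ 3 / 6) * (Real.exp (-(s * x)) * Real.cos (b i * x)) := by
      intro x
      simp only [hP, Finset.sum_div, Finset.sum_mul]
      refine Finset.sum_congr rfl fun i _ => ?_
      rw [mul_comm s x]; ring
    simp_rw [e3]
    rw [integral_finsetSum _ fun i _ => (aux_cos_exp_int (b i) s hs).const_mul _]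
    simp_rw [integral_const_mul, aux_cos_exp _ s hs]
    have e4 : ∀ i, c i * s ^ 3 / 6 * (s / (s ^ 2 + b i ^ 2)) =
        s ^ 2 / 6 * c i - 1 / 6 * (c i * b i ^ 2) + c i / 6 * (b i ^ 4 / (s ^ 2 + b i ^ 2)) := by
      intro i
      have : s ^ 2 + b i ^ 2 ≠ 0 := by positivity
      field_simp
      ring
    simp_rw [e4, Finset.sum_add_distrib, Finset.sum_sub_distrib, ← Finset.mul_sum, h0, h2]
    simp
  rw [setIntegral_congr_fun measurableSet_Ioi e2,
    integral_finsetSum _ fun i _ => (aux_arctan (b i)).1.const_mul _]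
  simp_rw [integral_const_mul, (aux_arctan _).2, Finset.mul_sum]
  refine Finset.sum_congr rfl fun i _ => ?_
  ring

lemma aux_K_int (lam : ℝ) :
    IntegrableOn (fun x : ℝ => Real.sin (lam * x) ^ 4 / x ^ 4) (Set.Ioi 0) := by
  have hg : IntegrableOn (fun x : ℝ => (2 * lam ^ 4 + 1) * (1 + x ^ 2)⁻¹) (Set.Ioi 0) :=
    (integrable_inv_one_add_sq.const_mul _).integrableOn
  refine Integrable.mono' hg ?_ ?_
  · apply Measurable.aestronglyMeasurable
    fun_prop
  · filter_upwards [ae_restrict_mem measurableSet_Ioi] with x hx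
    have hx : 0 < x := hx
    have h1 : Real.sin (lam * x) ^ 4 ≤ lam ^ 4 * x ^ 4 := by
      have : |Real.sin (lam * x)| ≤ |lam * x| := Real.abs_sin_le_abs
      have := pow_le_pow_left₀ (abs_nonneg _) this 4
      rw [Even.pow_abs (by decide), Even.pow_abs (by decide), mul_pow] at this
      exact this
    have h2 : Real.sin (lam * x) ^ 4 ≤ 1 := by
      have := pow_le_pow_left₀ (abs_nonneg _) (Real.abs_sin_le_one (lam * x)) 4
      rwa [Even.pow_abs (by decide), one_pow] at this
    have h3 : 0 ≤ Real.sin (lam * x) ^ 4 := by positivity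
    rw [Real.norm_of_nonneg (by positivity), ← div_eq_mul_inv, div_le_div_iff₀ (by positivity) (by positivity)]
    have h4 : 1 + x ^ 2 ≤ 2 + x ^ 4 := by nlinarith [sq_nonneg (x ^ 2 - 1)]
    have h5 : 0 ≤ x ^ 4 := by positivity
    calc _ ≤ Real.sin (lam * x) ^ 4 * (2 + x ^ 4) := by gcongr
      _ ≤ _ := by nlinarith

lemma aux_K_cos (lam a : ℝ) (ha : 0 ≤ a) (hl : a ≤ 2 * lam) :
    ∫ x in Set.Ioi (0:ℝ), Real.cos (a * x) * (Real.sin (lam * x) ^ 4 / x ^ 4) =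
      Real.pi * a ^ 3 / 32 + Real.pi * lam ^ 3 / 3 - Real.pi * lam * a ^ 2 / 8 := by
  have hint : IntegrableOn (fun x : ℝ => Real.cos (a * x) * (Real.sin (lam * x) ^ 4 / x ^ 4))
      (Set.Ioi 0) := by
    refine (aux_K_int lam).bdd_mul (c := 1) (by apply Continuous.aestronglyMeasurable; fun_prop) ?_
    exact Filter.Eventually.of_forall fun x => Real.abs_cos_le_one _
  have key : ∀ x : ℝ, Real.cos (a * x) * (Real.sin (lam * x) ^ 4 / x ^ 4) =
      (∑ i : Fin 5, (![3/8, -1/4, -1/4, 1/16, 1/16] : Fin 5 → ℝ) i *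
        Real.cos ((![a, a + 2 * lam, 2 * lam - a, a + 4 * lam, 4 * lam - a] : Fin 5 → ℝ) i * x)) / x ^ 4 := by
    intro x
    rw [← mul_div_assoc]
    congr 1
    simp only [Fin.sum_univ_five]
    simp
    have e1 : (a + 2 * lam) * x = a * x + 2 * (lam * x) := by ring
    have e2 : (2 * lam - a) * x = 2 * (lam * x) - a * x := by ring
    have e3 : (a + 4 * lam) * x = a * x + 2 * (2 * (lam * x)) := by ring
    have e4 : (4 * lam - a) * x = 2 * (2 * (lam * x)) - a * x := by ring
    rw [e1, e2, e3, e4, Real.cos_add, Real.cos_sub, Real.cos_add, Real.cos_sub,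
      Real.cos_two_mul (2 * (lam * x)), Real.cos_two_mul]
    have := Real.sin_sq (lam * x)
    rw [show Real.sin (lam * x) ^ 4 = (Real.sin (lam * x) ^ 2) ^ 2 by ring, this]
    ring
  simp_rw [key] at hint ⊢
  rw [aux_kernel _ _ _ ?_ ?_ hint]
  · simp only [Fin.sum_univ_five]
    simp
    rw [abs_of_nonneg ha, abs_of_nonneg (by linarith : 0 ≤ a + 2 * lam),
      abs_of_nonneg (by linarith : 0 ≤ 2 * lam - a),
      abs_of_nonneg (by linarith : 0 ≤ a + 4 * lam),
      abs_of_nonneg (by linarith : 0 ≤ 4 * lam - a)]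
    ring
  · simp only [Fin.sum_univ_five]
    simp
    norm_num
  · simp only [Fin.sum_univ_five]
    simp
    ring

lemma aux_congr {ι : Type} {f g : ι → ℝ} {a : ℝ} (h : ∀ i, f i = g i) (hg : HasSum g a) :
    HasSum f a := by
  rwa [show f = g from funext h]

lemma aux_antidiag {f : ℕ × ℕ → ℝ} {a : ℝ} (h : HasSum f a) :
    HasSum (fun n => ∑ i ∈ Finset.HasAntidiagonal.antidiagonal n, f i) a := by
  have h2 := (Finset.HasAntidiagonal.sigmaAntidiagonalEquivProd (A := ℕ)).hasSum_iff.mpr h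
  have h3 := h2.sigma (fun n => hasSum_fintype _)
  refine aux_congr (fun n => ?_) h3
  simp only [Function.comp_apply, Finset.HasAntidiagonal.sigmaAntidiagonalEquivProd_apply]
  rw [Finset.sum_coe_sort (Finset.HasAntidiagonal.antidiagonal n) f]

lemma aux_beta_rec (p k : ℕ) : ∫ t in (0:ℝ)..1, t ^ p * (1 - t ^ 2) ^ (k + 1) =
    (∫ t in (0:ℝ)..1, t ^ p * (1 - t ^ 2) ^ k) - ∫ t in (0:ℝ)..1, t ^ (p + 2) * (1 - t ^ 2) ^ k := by
  rw [← intervalIntegral.integral_sub]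
  · congr 1; ext t; ring
  · apply Continuous.intervalIntegrable; fun_prop
  · apply Continuous.intervalIntegrable; fun_prop

lemma aux_beta_even (k : ℕ) : ∀ m : ℕ, ∫ t in (0:ℝ)..1, t ^ (2 * m) * (1 - t ^ 2) ^ k =
    4 ^ k * (k ! : ℝ) * ((2 * m)! : ℝ) * ((m + k)! : ℝ) / ((m ! : ℝ) * ((2 * m + 2 * k + 1)! : ℝ)) := by
  induction k with
  | zero =>
    intro m
    have : ((m ! : ℕ) : ℝ) ≠ 0 := by positivity
    have : (((2 * m)! : ℕ) : ℝ) ≠ 0 := by positivity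
    simp [Nat.factorial_succ]
    field_simp
  | succ k ih =>
    intro m
    rw [aux_beta_rec, show 2 * m + 2 = 2 * (m + 1) by ring, ih, ih]
    have h1 : ((m ! : ℕ) : ℝ) ≠ 0 := by positivity
    have h2 : (((2 * m)! : ℕ) : ℝ) ≠ 0 := by positivity
    have h3 : (((m + k)! : ℕ) : ℝ) ≠ 0 := by positivity
    have h4 : (((2 * m + 2 * k + 1)! : ℕ) : ℝ) ≠ 0 := by positivity
    rw [show m + 1 + k = m + k + 1 by ring, show m + (k + 1) = m + k + 1 by ring,
      show 2 * (m + 1) + 2 * k + 1 = (2 * m + 2 * k + 1) + 1 + 1 by ring,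
      show 2 * m + 2 * (k + 1) + 1 = (2 * m + 2 * k + 1) + 1 + 1 by ring,
      show 2 * (m + 1) = 2 * m + 1 + 1 by ring]
    rw [Nat.factorial_succ (2 * m + 2 * k + 1 + 1), Nat.factorial_succ (2 * m + 2 * k + 1),
      Nat.factorial_succ (2 * m + 1), Nat.factorial_succ (2 * m), Nat.factorial_succ (m + k),
      Nat.factorial_succ m, Nat.factorial_succ k]
    push_cast
    have h5 : (2 * (m:ℝ) + 2 * k + 1 + 1) ≠ 0 := by positivity
    have h6 : (2 * (m:ℝ) + 2 * k + 1 + 1 + 1) ≠ 0 := by positivity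
    field_simp
    ring

lemma aux_beta_odd (k : ℕ) : ∀ m : ℕ, ∫ t in (0:ℝ)..1, t ^ (2 * m + 1) * (1 - t ^ 2) ^ k =
    (m ! : ℝ) * (k ! : ℝ) / (2 * ((m + k + 1)! : ℝ)) := by
  induction k with
  | zero =>
    intro m
    have : ((m ! : ℕ) : ℝ) ≠ 0 := by positivity
    simp [Nat.factorial_succ]
    field_simp
    ring
  | succ k ih =>
    intro m
    rw [aux_beta_rec, show 2 * m + 1 + 2 = 2 * (m + 1) + 1 by ring, ih, ih]
    have h1 : ((m ! : ℕ) : ℝ) ≠ 0 := by positivity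
    have h4 : (((m + k + 1)! : ℕ) : ℝ) ≠ 0 := by positivity
    rw [show m + 1 + k + 1 = m + k + 1 + 1 by ring, show m + (k + 1) + 1 = m + k + 1 + 1 by ring]
    rw [Nat.factorial_succ (m + k + 1), 
      Nat.factorial_succ m, Nat.factorial_succ k]
    push_cast
    have h5 : ((m:ℝ) + k + 1 + 1) ≠ 0 := by positivity
    field_simp
    ring

/-- the coefficients of `J₀(σ √u)` -/
noncomputable def auxC (σ : ℝ) (k : ℕ) : ℝ := (-1) ^ k * (σ ^ 2 / 4) ^ k / ((k ! : ℝ)) ^ 2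

noncomputable def auxH (σ t : ℝ) : ℝ := ∑' k, auxC σ k * (1 - t ^ 2) ^ k

lemma auxC_norm_summable (σ : ℝ) : Summable (fun k => ‖auxC σ k‖) := by
  refine Summable.of_nonneg_of_le (fun _ => norm_nonneg _) (fun k => ?_)
    (Real.summable_pow_div_factorial (σ ^ 2 / 4))
  have h1 : (1:ℝ) ≤ (k ! : ℝ) := by exact_mod_cast Nat.factorial_pos k
  unfold auxC
  rw [norm_div, norm_mul, norm_pow, norm_neg, norm_one, one_pow, one_mul,
    Real.norm_of_nonneg (by positivity), Real.norm_of_nonneg (by positivity)]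
  gcongr
  nlinarith

lemma aux_pow_bound (t : ℝ) (ht : t ∈ Set.Icc (0:ℝ) 1) (k : ℕ) : ‖(1 - t ^ 2) ^ k‖ ≤ 1 := by
  rw [norm_pow]
  apply pow_le_one₀ (norm_nonneg _)
  rw [Real.norm_eq_abs, abs_le]
  constructor <;> nlinarith [ht.1, ht.2]

lemma auxH_summable (σ t : ℝ) (ht : t ∈ Set.Icc (0:ℝ) 1) :
    Summable (fun k => auxC σ k * (1 - t ^ 2) ^ k) := by
  refine Summable.of_norm_bounded (auxC_norm_summable σ) fun k => ?_
  rw [norm_mul]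
  exact mul_le_of_le_one_right (norm_nonneg _) (aux_pow_bound t ht k)

lemma auxH_cont (σ : ℝ) : ContinuousOn (auxH σ) (Set.Icc 0 1) := by
  unfold auxH
  refine continuousOn_tsum (fun k => by fun_prop) (auxC_norm_summable σ) fun k t ht => ?_
  rw [norm_mul]
  exact mul_le_of_le_one_right (norm_nonneg _) (aux_pow_bound t ht k)

lemma aux_hasSum {ι : Type} [Countable ι] (F : ι → ℝ → ℝ) (B : ι → ℝ) (hB : Summable B)
    (hF : ∀ i, Continuous (F i)) (hb : ∀ i, ∀ t ∈ Set.Icc (0:ℝ) 1, ‖F i t‖ ≤ B i) (G : ℝ → ℝ)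
    (hG : ∀ t ∈ Set.Icc (0:ℝ) 1, HasSum (fun i => F i t) (G t)) :
    HasSum (fun i => ∫ t in (0:ℝ)..1, F i t) (∫ t in (0:ℝ)..1, G t) := by
  refine intervalIntegral.hasSum_integral_of_dominated_convergence (fun i _ => B i)
    (fun i => (hF i).aestronglyMeasurable) ?_ ?_ ?_ ?_
  · intro i
    refine Filter.Eventually.of_forall fun t ht => hb i t ?_
    rw [Set.uIoc_of_le zero_le_one] at ht
    exact ⟨ht.1.le, ht.2⟩
  · exact Filter.Eventually.of_forall fun t ht => hB
  · simp
  · refine Filter.Eventually.of_forall fun t ht => hG t ?_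
    rw [Set.uIoc_of_le zero_le_one] at ht
    exact ⟨ht.1.le, ht.2⟩

lemma auxH_hasSum (σ : ℝ) (p : ℕ) :
    HasSum (fun k => auxC σ k * ∫ t in (0:ℝ)..1, t ^ p * (1 - t ^ 2) ^ k)
      (∫ t in (0:ℝ)..1, auxH σ t * t ^ p) := by
  have := aux_hasSum (fun k t => auxC σ k * (t ^ p * (1 - t ^ 2) ^ k)) (fun k => ‖auxC σ k‖)
    (auxC_norm_summable σ) (fun k => by fun_prop) (fun k t ht => by
      rw [norm_mul, norm_mul]
      refine mul_le_of_le_one_right (norm_nonneg _) ?_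
      refine mul_le_one₀ ?_ (norm_nonneg _) (aux_pow_bound t ht k)
      rw [norm_pow]
      apply pow_le_one₀ (norm_nonneg _)
      rw [Real.norm_of_nonneg ht.1]; exact ht.2) (fun t => auxH σ t * t ^ p) (fun t ht => by
      have := (auxH_summable σ t ht).hasSum.mul_right (t ^ p)
      unfold auxH
      refine (aux_congr fun k => ?_) this
      ring)
  simpa using this

lemma aux_sinc (z : ℝ) (hz : 0 < z) :
    HasSum (fun n : ℕ => (-1) ^ n * (z ^ 2) ^ n / ((2 * n + 1)! : ℝ)) (Real.sin z / z) := by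
  have := (Real.hasSum_sin z).div_const z
  refine (aux_congr fun n => ?_) this
  rw [← pow_mul, pow_succ]
  field_simp

lemma aux_term (σ y : ℝ) (n k m : ℕ) (hi : k + m = n) :
    ∫ t in (0:ℝ)..1, (auxC σ k * (1 - t ^ 2) ^ k) * ((-1) ^ m * (y * t) ^ (2 * m) / ((2 * m)! : ℝ)) =
    (-1) ^ n * (n.choose k • ((σ ^ 2) ^ k * (y ^ 2) ^ m)) / ((2 * n + 1)! : ℝ) := by
  have e : ∀ t : ℝ, (auxC σ k * (1 - t ^ 2) ^ k) * ((-1) ^ m * (y * t) ^ (2 * m) / ((2 * m)! : ℝ)) =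
      (auxC σ k * (-1) ^ m * y ^ (2 * m) / ((2 * m)! : ℝ)) * (t ^ (2 * m) * (1 - t ^ 2) ^ k) := by
    intro t; rw [mul_pow]; ring
  simp_rw [e]
  rw [intervalIntegral.integral_const_mul, aux_beta_even, ← hi]
  unfold auxC
  have hch : ((k + m).choose k : ℝ) = ((k + m)! : ℝ) / ((k ! : ℝ) * (m ! : ℝ)) := by
    rw [Nat.cast_choose ℝ (Nat.le_add_right k m)]; simp
  have h1 : ((m ! : ℕ) : ℝ) ≠ 0 := by positivity
  have h1 : ((k ! : ℕ) : ℝ) ≠ 0 := by positivity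
  have h2 : (((2 * m)! : ℕ) : ℝ) ≠ 0 := by positivity
  have h3 : (((m + k)! : ℕ) : ℝ) ≠ 0 := by positivity
  have h4 : (((2 * m + 2 * k + 1)! : ℕ) : ℝ) ≠ 0 := by positivity
  rw [nsmul_eq_mul, hch, show k + m = m + k by ring, show 2 * (m + k) + 1 = 2 * m + 2 * k + 1 by ring,
    pow_add, div_pow, pow_mul]
  field_simp

lemma aux_repr1 (σ y : ℝ) :
    HasSum (fun i : ℕ × ℕ => ∫ t in (0:ℝ)..1, (auxC σ i.1 * (1 - t ^ 2) ^ i.1) *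
      ((-1) ^ i.2 * (y * t) ^ (2 * i.2) / ((2 * i.2)! : ℝ)))
      (∫ t in (0:ℝ)..1, auxH σ t * Real.cos (y * t)) := by
  have hcos : Summable fun m : ℕ => ‖y ^ (2 * m) / ((2 * m)! : ℝ)‖ :=
    (Real.hasSum_cosh y).summable.norm
  have hB : Summable fun i : ℕ × ℕ => ‖auxC σ i.1‖ * ‖y ^ (2 * i.2) / ((2 * i.2)! : ℝ)‖ :=
    Summable.mul_of_nonneg (auxC_norm_summable σ) hcos (fun _ => norm_nonneg _)
      (fun _ => norm_nonneg _)
  refine aux_hasSum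
    (fun (i : ℕ × ℕ) t => (auxC σ i.1 * (1 - t ^ 2) ^ i.1) *
      ((-1) ^ i.2 * (y * t) ^ (2 * i.2) / ((2 * i.2)! : ℝ))) _ hB (fun i => by fun_prop) ?_
      (fun t => auxH σ t * Real.cos (y * t)) ?_
  · rintro ⟨k, m⟩ t ht
    simp only
    have h1 : ‖auxC σ k * (1 - t ^ 2) ^ k‖ ≤ ‖auxC σ k‖ := by
      rw [norm_mul]
      exact mul_le_of_le_one_right (norm_nonneg _) (aux_pow_bound t ht k)
    have h2 : ‖(-1) ^ m * (y * t) ^ (2 * m) / ((2 * m)! : ℝ)‖ ≤ ‖y ^ (2 * m) / ((2 * m)! : ℝ)‖ := by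
      rw [norm_div, norm_mul, norm_pow, norm_neg, norm_one, one_pow, one_mul, norm_div, mul_pow,
          norm_mul]
      refine div_le_div_of_nonneg_right ?_ (norm_nonneg _)
      refine mul_le_of_le_one_right (norm_nonneg _) ?_
      rw [norm_pow]
      apply pow_le_one₀ (norm_nonneg _)
      rw [Real.norm_of_nonneg ht.1]; exact ht.2
    rw [norm_mul]
    exact mul_le_mul h1 h2 (norm_nonneg _) (norm_nonneg _)
  · intro t ht
    have hs1 := auxH_summable σ t ht
    have hs1' : HasSum (fun k => auxC σ k * (1 - t ^ 2) ^ k) (auxH σ t) := hs1.hasSum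
    have hs2 := Real.hasSum_cos (y * t)
    have hs3 := summable_mul_of_summable_norm hs1.norm hs2.summable.norm
    have hs4 := hs1'.mul hs2 hs3
    exact hs4

lemma aux_repr2 (σ y : ℝ) (hσ : 0 < σ) :
    ∫ t in (0:ℝ)..1, auxH σ t * Real.cos (y * t) =
      Real.sin (Real.sqrt (y ^ 2 + σ ^ 2)) / Real.sqrt (y ^ 2 + σ ^ 2) := by
  have h3 := aux_antidiag (aux_repr1 σ y)
  have h4 := aux_sinc (Real.sqrt (y ^ 2 + σ ^ 2)) (by positivity)
  rw [Real.sq_sqrt (by positivity)] at h4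
  refine h3.unique ?_
  refine aux_congr (fun n => ?_) h4
  rw [add_comm (y ^ 2), (Commute.all (σ ^ 2) (y ^ 2)).add_pow', Finset.mul_sum, Finset.sum_div]
  refine Finset.sum_congr rfl fun i hi => ?_
  obtain ⟨k, m⟩ := i
  rw [Finset.HasAntidiagonal.mem_antidiagonal] at hi
  exact aux_term σ y n k m hi

lemma aux_repr (σ τ x : ℝ) (hσ : 0 < σ) :
    ∫ t in (0:ℝ)..1, auxH σ t * Real.cos (τ * x * t) =
      Real.sin (Real.sqrt (τ ^ 2 * x ^ 2 + σ ^ 2)) / Real.sqrt (τ ^ 2 * x ^ 2 + σ ^ 2) := by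
  rw [aux_repr2 σ (τ * x) hσ, mul_pow]

lemma aux_m0 (σ : ℝ) (hσ : 0 < σ) : ∫ t in (0:ℝ)..1, auxH σ t = Real.sin σ / σ := by
  have := aux_repr σ 0 0 hσ
  simpa [Real.sqrt_sq hσ.le] using this

lemma aux_m2 (σ : ℝ) (hσ : 0 < σ) :
    ∫ t in (0:ℝ)..1, auxH σ t * t ^ 2 = - (σ * Real.cos σ - Real.sin σ) / σ ^ 3 := by
  refine (auxH_hasSum σ 2).unique ?_
  have h := ((Real.hasSum_sin σ).sub ((Real.hasSum_cos σ).mul_left σ))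
  rw [← hasSum_nat_add_iff' 1] at h
  have h := h.div_const (σ ^ 3)
  simp only [Finset.sum_range_one] at h
  have e : - (σ * Real.cos σ - Real.sin σ) / σ ^ 3 = (Real.sin σ - σ * Real.cos σ -
        ((-1) ^ 0 * σ ^ (2 * 0 + 1) / ((2 * 0 + 1)! : ℝ) - σ * ((-1) ^ 0 * σ ^ (2 * 0) / ((2 * 0)! : ℝ)))) /
      σ ^ 3 := by
    simp
  rw [e]
  refine (aux_congr fun k => ?_) h
  · have := aux_beta_even k 1
    simp only [mul_one] at this
    rw [this]
    unfold auxC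
    rw [show 2 + 2 * k + 1 = 2 * (k + 1) + 1 by ring, Nat.factorial_succ (2 * (k + 1)),
      show 1 + k = k + 1 by ring, Nat.factorial_succ k]
    have h1 : ((k ! : ℕ) : ℝ) ≠ 0 := by positivity
    have h2 : (((2 * (k + 1))! : ℕ) : ℝ) ≠ 0 := by positivity
    push_cast
    rw [div_pow, ← pow_mul]
    norm_num
    field_simp
    ring

lemma aux_m3 (σ : ℝ) (hσ : 0 < σ) :
    ∫ t in (0:ℝ)..1, auxH σ t * t ^ 3 = 2 / σ ^ 2 *
      ∑' k : ℕ, ((-1 : ℝ) ^ k / ((k ! : ℝ) * ((k + 2)! : ℝ))) * (σ / 2) ^ (2 * k + 2) := by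
  rw [← (auxH_hasSum σ 3).tsum_eq, ← tsum_mul_left]
  congr 1
  ext k
  have := aux_beta_odd k 1
  norm_num at this
  rw [this]
  unfold auxC
  rw [show 1 + k + 1 = k + 2 by ring, pow_add, pow_mul, div_pow σ 2 2]
  have h1 : ((k ! : ℕ) : ℝ) ≠ 0 := by positivity
  have h2 : (((k + 2)! : ℕ) : ℝ) ≠ 0 := by positivity
  norm_num
  field_simp
  try ring

lemma auxH_intervalIntegrable (σ : ℝ) (g : ℝ → ℝ) (hg : Continuous g) :
    IntervalIntegrable (fun t => auxH σ t * g t) volume 0 1 := by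
  apply ContinuousOn.intervalIntegrable
  rw [Set.uIcc_of_le zero_le_one]
  exact (auxH_cont σ).mul hg.continuousOn

/-- Example of Theorem 1 with `m = 2`: explicit evaluation of the Sinc transform of
`sin(√(τ²x² + σ²))/√(τ²x² + σ²)` with kernel `sin⁴(λx)/x⁴` for `λ > τ/2`, where
`J₂` is the Bessel function of the first kind of order 2 given by its power series. -/
theorem sinc_transform_example_even
    (τ σ lam : ℝ) (hτ : 0 < τ) (hσ : 0 < σ) (hlam : τ / 2 < lam) :
    (∫ x in Set.Ioi (0 : ℝ),
        (Real.sin (Real.sqrt (τ ^ 2 * x ^ 2 + σ ^ 2)) /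
            Real.sqrt (τ ^ 2 * x ^ 2 + σ ^ 2)) *
          ((Real.sin (lam * x)) ^ 4 / x ^ 4))
      = (Real.pi * τ ^ 3 / (16 * σ ^ 2)) *
            (∑' k : ℕ, ((-1 : ℝ) ^ k / ((k ! : ℝ) * ((k + 2)! : ℝ))) * (σ / 2) ^ (2 * k + 2)) +
          (Real.pi * τ ^ 2 * lam / (8 * σ ^ 3)) * (σ * Real.cos σ - Real.sin σ) +
          (Real.pi * lam ^ 3 / (3 * σ)) * Real.sin σ := by
  have hH : Integrable (auxH σ) (volume.restrict (Set.uIoc 0 1)) := by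
    have := (auxH_intervalIntegrable σ (fun _ => 1) continuous_const)
    rw [intervalIntegrable_iff, IntegrableOn] at this
    simpa using this
  have hI : Integrable (Function.uncurry fun t x : ℝ =>
      Real.cos (τ * x * t) * (auxH σ t * (Real.sin (lam * x) ^ 4 / x ^ 4)))
      ((volume.restrict (Set.uIoc 0 1)).prod (volume.restrict (Set.Ioi 0))) := by
    refine (hH.mul_prod (aux_K_int lam)).bdd_mul (c := 1) (f := fun z : ℝ × ℝ => Real.cos (τ * z.2 * z.1)) ?_ ?_
    · apply Continuous.aestronglyMeasurable
      fun_prop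
    · exact Filter.Eventually.of_forall fun z => Real.abs_cos_le_one _
  have hswap := intervalIntegral_integral_swap hI
  have e1 : ∀ x : ℝ, ∫ t in (0:ℝ)..1,
      Real.cos (τ * x * t) * (auxH σ t * (Real.sin (lam * x) ^ 4 / x ^ 4)) =
      (Real.sin (Real.sqrt (τ ^ 2 * x ^ 2 + σ ^ 2)) / Real.sqrt (τ ^ 2 * x ^ 2 + σ ^ 2)) *
          ((Real.sin (lam * x)) ^ 4 / x ^ 4) := by
    intro x
    rw [← aux_repr σ τ x hσ, ← intervalIntegral.integral_mul_const]
    congr 1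
    ext t
    ring
  simp_rw [e1] at hswap
  rw [← hswap]
  have e2 : ∀ t ∈ Set.uIcc (0:ℝ) 1, ∫ x in Set.Ioi (0:ℝ),
      Real.cos (τ * x * t) * (auxH σ t * (Real.sin (lam * x) ^ 4 / x ^ 4)) =
      Real.pi * τ ^ 3 / 32 * (auxH σ t * t ^ 3) + Real.pi * lam ^ 3 / 3 * auxH σ t
        - Real.pi * lam * τ ^ 2 / 8 * (auxH σ t * t ^ 2) := by
    intro t ht
    rw [Set.uIcc_of_le zero_le_one] at ht
    have h := aux_K_cos lam (τ * t) (mul_nonneg hτ.le ht.1) (by nlinarith [ht.2])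
    have : ∀ x : ℝ, Real.cos (τ * x * t) * (auxH σ t * (Real.sin (lam * x) ^ 4 / x ^ 4)) =
        auxH σ t * (Real.cos (τ * t * x) * (Real.sin (lam * x) ^ 4 / x ^ 4)) := by
      intro x
      rw [show τ * x * t = τ * t * x by ring]
      ring
    simp_rw [this]
    rw [integral_const_mul, h]
    ring
  rw [intervalIntegral.integral_congr e2]
  have i0 : IntervalIntegrable (fun t => auxH σ t) volume 0 1 := by
    simpa using auxH_intervalIntegrable σ (fun _ => 1) continuous_const
  have i2 := auxH_intervalIntegrable σ (fun t => t ^ 2) (by fun_prop)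
  have i3 := auxH_intervalIntegrable σ (fun t => t ^ 3) (by fun_prop)
  rw [intervalIntegral.integral_sub ((i3.const_mul _).add (i0.const_mul _)) (i2.const_mul _),
    intervalIntegral.integral_add (i3.const_mul _) (i0.const_mul _),
    intervalIntegral.integral_const_mul, intervalIntegral.integral_const_mul,
    intervalIntegral.integral_const_mul, aux_m0 σ hσ, aux_m2 σ hσ, aux_m3 σ hσ]
  field_simp
  ring
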